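/- Let Z ⊆ ℝⁿ be closed, U ⊆ ℝⁿ × ℝ open containing ℝⁿ × {0}, W ⊆ U a closed subset containing Z × {0}, and u : ℝⁿ → U the map u(p) = (p,0). Let J ⊆ C^∞(ℝⁿ) be an ideal whose zero set is Z. Define I'_W = {g ∈ C^∞(U) : g|_W = 0 and g ∘ u ∈ J}. Then the zero set of the ideal I'_W equals W, provided W ∩ (ℝⁿ × {0}) = Z × {0}. -/

import Mathlib

/-- The `ℝ`-algebra of smooth real-valued functions on `ℝⁿ`. -/
def smoothAlg (n : ℕ) : Subalgebra ℝ (EuclideanSpace ℝ (Fin n) → ℝ) where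
  carrier := {f | ContDiff ℝ (⊤ : ℕ∞) f}
  mul_mem' := fun {a b} hf hg =>
    ((show ContDiff ℝ (⊤ : ℕ∞) a from hf).mul (show ContDiff ℝ (⊤ : ℕ∞) b from hg) :
      ContDiff ℝ (⊤ : ℕ∞) (a * b))
  add_mem' := fun {a b} hf hg =>
    ((show ContDiff ℝ (⊤ : ℕ∞) a from hf).add (show ContDiff ℝ (⊤ : ℕ∞) b from hg) :
      ContDiff ℝ (⊤ : ℕ∞) (a + b))
  one_mem' := (contDiff_const : ContDiff ℝ (⊤ : ℕ∞) fun _ => (1 : ℝ))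
  zero_mem' := (contDiff_const : ContDiff ℝ (⊤ : ℕ∞) fun _ => (0 : ℝ))
  algebraMap_mem' := fun r => (contDiff_const : ContDiff ℝ (⊤ : ℕ∞) fun _ => r)

/-- The zero set of the ideal `I'_W = {g : g|_W = 0, g ∘ u ∈ J}` equals `W`. -/
theorem zero_set_IW {n : ℕ}
    (Z : Set (EuclideanSpace ℝ (Fin n))) (hZ : IsClosed Z)
    (U : Set (EuclideanSpace ℝ (Fin n) × ℝ)) (hU : IsOpen U)
    (hU0 : ∀ p : EuclideanSpace ℝ (Fin n), (p, (0 : ℝ)) ∈ U)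
    (W : Set (EuclideanSpace ℝ (Fin n) × ℝ)) (hWU : W ⊆ U)
    (hWclosed : ∃ F, IsClosed F ∧ W = F ∩ U)
    (J : Ideal (smoothAlg n))
    (hJZ : {p | ∀ j ∈ J, j.1 p = 0} = Z)
    (hW0 : {q | q ∈ W ∧ q.2 = 0}
        = {q : EuclideanSpace ℝ (Fin n) × ℝ | q.1 ∈ Z ∧ q.2 = 0}) :
    {q ∈ U | ∀ g : EuclideanSpace ℝ (Fin n) × ℝ → ℝ,
        ContDiffOn ℝ (⊤ : ℕ∞) g U → (∀ w ∈ W, g w = 0) →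
        (∃ j ∈ J, ∀ p, j.1 p = g (p, 0)) → g q = 0} = W := by
  obtain ⟨F, hF, hWF⟩ := hWclosed
  apply Set.Subset.antisymm
  · rintro ⟨p, t⟩ ⟨hqU, hq⟩
    by_contra hqW
    have hqF : (p, t) ∉ F := fun h => hqW (by rw [hWF]; exact ⟨h, hqU⟩)
    obtain ⟨f, hfs, hf, -⟩ := hF.isOpen_compl.exists_contDiff_support_eq (n := (⊤ : ℕ∞))
    have hfq : f (p, t) ≠ 0 := by
      have : (p, t) ∈ Function.support f := by rw [hfs]; exact hqF
      exact this
    have hfW : ∀ w ∈ W, f w = 0 := by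
      intro w hw
      by_contra h
      have h2 : w ∈ Function.support f := h
      rw [hfs] at h2
      rw [hWF] at hw
      exact h2 hw.1
    by_cases ht : t = 0
    · subst ht
      have hpZ : p ∉ Z := by
        intro hp
        have h : ((p, 0) : EuclideanSpace ℝ (Fin n) × ℝ) ∈ {q | q ∈ W ∧ q.2 = 0} := by
          rw [hW0]; exact ⟨hp, rfl⟩
        exact hqW h.1
      rw [← hJZ] at hpZ
      simp only [Set.mem_setOf_eq, not_forall] at hpZ
      obtain ⟨j, hj, hjp⟩ := hpZ
      have hjs : ContDiff ℝ (⊤ : ℕ∞) j.1 := j.2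
      have hf0 : ContDiff ℝ (⊤ : ℕ∞) (fun x : EuclideanSpace ℝ (Fin n) => f (x, 0)) :=
        hf.comp (contDiff_id.prodMk contDiff_const)
      have := hq (fun q => f q * j.1 q.1) (hf.mul (hjs.comp contDiff_fst)).contDiffOn
        (fun w hw => by simp [hfW w hw])
        ⟨(⟨_, hf0⟩ : smoothAlg n) * j, J.mul_mem_left _ hj, fun x => rfl⟩
      exact (mul_ne_zero hfq hjp) this
    · have := hq (fun q => f q * q.2) (hf.mul contDiff_snd).contDiffOn
        (fun w hw => by simp [hfW w hw])
        ⟨0, J.zero_mem, fun x => by simp⟩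
      exact (mul_ne_zero hfq ht) this
  · intro q hq
    exact ⟨hWU hq, fun g _ hg _ => hg q hq⟩
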